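/- Let 0 < β < 1. Assume the core energies Q_GL and Q_{[1,0]}(β) exist, and assume that for each ε ∈ (0,1) there is a map u_ε, admissible for the scalar problem, with G_ε(u_ε) = I_GL(ε) and (1/ε²)·∫_{D₁}(1−|u_ε|²)² dx → 2π as ε → 0⁺. Then 2·Q_{[1,0]}(β) ≤ Q_GL − (1−β)·π/4. -/

import Mathlib

open MeasureTheory Metric Set Filter Complex

noncomputable section

/-- Sum of squared norms of the two first-order partial derivatives (plane identified with `ℂ`). -/
def gradSq (f : ℂ → ℂ) (x : ℂ) : ℝ :=
  ‖fderiv ℝ f x 1‖ ^ 2 + ‖fderiv ℝ f x Complex.I‖ ^ 2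

/-- Two-component Ginzburg–Landau energy density on the unit disk. -/
def eDen (ε β : ℝ) (ψp ψm : ℂ → ℂ) (x : ℂ) : ℝ :=
  (1 / 2) * (gradSq ψp x + gradSq ψm x)
    + (1 / (4 * ε ^ 2)) * ((‖ψp x‖ ^ 2 + ‖ψm x‖ ^ 2 - 1) ^ 2)
    + (β / (4 * ε ^ 2)) * ((‖ψp x‖ ^ 2 - ‖ψm x‖ ^ 2) ^ 2)

/-- Two-component Ginzburg–Landau energy on the unit disk. -/
def En (ε β : ℝ) (ψp ψm : ℂ → ℂ) : ℝ := ∫ x in ball (0 : ℂ) 1, eDen ε β ψp ψm x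

/-- Scalar Ginzburg–Landau energy density. -/
def gDen (ε : ℝ) (u : ℂ → ℂ) (x : ℂ) : ℝ :=
  (1 / 2) * gradSq u x + (1 / (4 * ε ^ 2)) * ((1 - ‖u x‖ ^ 2) ^ 2)

/-- Scalar Ginzburg–Landau energy on the unit disk. -/
def Gn (ε : ℝ) (u : ℂ → ℂ) : ℝ := ∫ x in ball (0 : ℂ) 1, gDen ε u x

/-- Admissible two-component map with boundary degrees `(np, nm)`. -/
def AdmissiblePair (ε β : ℝ) (np nm : ℕ) (ψp ψm : ℂ → ℂ) : Prop :=
  ContinuousOn ψp (closedBall 0 1) ∧ ContinuousOn ψm (closedBall 0 1) ∧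
  ContDiffOn ℝ 1 ψp (ball 0 1) ∧ ContDiffOn ℝ 1 ψm (ball 0 1) ∧
  IntegrableOn (eDen ε β ψp ψm) (ball 0 1) ∧
  ∀ x : ℂ, ‖x‖ = 1 →
    ψp x = (Real.sqrt 2 : ℂ)⁻¹ * x ^ np ∧ ψm x = (Real.sqrt 2 : ℂ)⁻¹ * x ^ nm

/-- The infimum `I_{[np,nm]}(ε;β)`. -/
def Ival (ε β : ℝ) (np nm : ℕ) : ℝ :=
  sInf { e : ℝ | ∃ ψp ψm : ℂ → ℂ, AdmissiblePair ε β np nm ψp ψm ∧ e = En ε β ψp ψm }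

/-- Admissible scalar map with degree-one boundary condition. -/
def AdmissibleScalar (ε : ℝ) (u : ℂ → ℂ) : Prop :=
  ContinuousOn u (closedBall 0 1) ∧ ContDiffOn ℝ 1 u (ball 0 1) ∧
  IntegrableOn (gDen ε u) (ball 0 1) ∧ ∀ x : ℂ, ‖x‖ = 1 → u x = x

/-- The infimum `I_GL(ε)`. -/
def IGL (ε : ℝ) : ℝ :=
  sInf { e : ℝ | ∃ u : ℂ → ℂ, AdmissibleScalar ε u ∧ e = Gn ε u }

/-- Spin of a two-component map. -/
def spin (ψp ψm : ℂ → ℂ) (x : ℂ) : ℝ := (1 / 2) * (‖ψm x‖ ^ 2 - ‖ψp x‖ ^ 2)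

lemma gradSq_const_mul (c : ℂ) {f : ℂ → ℂ} {x : ℂ} (hf : DifferentiableAt ℝ f x) :
    gradSq (fun y => c * f y) x = ‖c‖ ^ 2 * gradSq f x := by
  simp only [gradSq, fderiv_const_mul hf, smul_apply, smul_eq_mul, norm_mul]
  ring

lemma gradSq_const (c x : ℂ) : gradSq (fun _ => c) x = 0 := by
  simp [gradSq]

lemma norm_inv_sqrt_two_sq : ‖((Real.sqrt 2 : ℂ)⁻¹)‖ ^ 2 = 1 / 2 := by
  rw [norm_inv, Complex.norm_real, Real.norm_of_nonneg (Real.sqrt_nonneg 2), inv_pow,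
    Real.sq_sqrt zero_le_two, one_div]

lemma eDen_scalar_const (ε β : ℝ) {u : ℂ → ℂ} {x : ℂ} (hu : DifferentiableAt ℝ u x) :
    eDen ε β (fun y => (Real.sqrt 2 : ℂ)⁻¹ * u y) (fun _ => (Real.sqrt 2 : ℂ)⁻¹) x
      = (1 / 2) * gDen ε u x - ((1 - β) / 16 * (1 / ε ^ 2)) * (1 - ‖u x‖ ^ 2) ^ 2 := by
  simp only [eDen, gDen, gradSq_const_mul _ hu, gradSq_const, norm_mul, mul_pow,
    norm_inv_sqrt_two_sq]
  ring

lemma En_nonneg {ε β : ℝ} (hβ : 0 ≤ β) (ψp ψm : ℂ → ℂ) : 0 ≤ En ε β ψp ψm := by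
  refine integral_nonneg fun x => ?_
  simp only [Pi.zero_apply, eDen, gradSq]
  positivity

lemma Ival_le {ε β : ℝ} (hβ : 0 ≤ β) {np nm : ℕ} {ψp ψm : ℂ → ℂ}
    (h : AdmissiblePair ε β np nm ψp ψm) : Ival ε β np nm ≤ En ε β ψp ψm := by
  refine csInf_le ⟨0, ?_⟩ ⟨ψp, ψm, h, rfl⟩
  rintro _ ⟨φp, φm, -, rfl⟩
  exact En_nonneg hβ φp φm

/-- Pairing a scalar competitor with a constant component bounds the `[1,0]` infimum. -/
lemma Ival_one_zero_le {ε β : ℝ} (hβ : 0 ≤ β) {u : ℂ → ℂ} (hu : AdmissibleScalar ε u) :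
    Ival ε β 1 0 ≤ (1 / 2) * Gn ε u
      - (1 - β) / 16 * ((1 / ε ^ 2) * ∫ x in ball (0 : ℂ) 1, (1 - ‖u x‖ ^ 2) ^ 2) := by
  obtain ⟨hc, hd, hi, hb⟩ := hu
  have hW : IntegrableOn (fun x => (1 - ‖u x‖ ^ 2) ^ 2) (ball (0 : ℂ) 1) :=
    (ContinuousOn.integrableOn_compact (isCompact_closedBall 0 1)
      ((continuousOn_const.sub (hc.norm.pow 2)).pow 2)).mono_set ball_subset_closedBall
  have heq : EqOn (eDen ε β (fun y => (Real.sqrt 2 : ℂ)⁻¹ * u y) (fun _ => (Real.sqrt 2 : ℂ)⁻¹))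
      (fun x => (1 / 2) * gDen ε u x - ((1 - β) / 16 * (1 / ε ^ 2)) * (1 - ‖u x‖ ^ 2) ^ 2)
      (ball 0 1) := fun x hx => eDen_scalar_const ε β
    ((hd.differentiableOn one_ne_zero).differentiableAt (isOpen_ball.mem_nhds hx))
  have hadm : AdmissiblePair ε β 1 0 (fun y => (Real.sqrt 2 : ℂ)⁻¹ * u y)
      (fun _ => (Real.sqrt 2 : ℂ)⁻¹) := by
    refine ⟨continuousOn_const.mul hc, continuousOn_const, contDiffOn_const.mul hd,
      contDiffOn_const, ?_, fun x hx => ⟨by simp [hb x hx], by simp⟩⟩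
    exact IntegrableOn.congr_fun ((hi.const_mul _).sub (hW.const_mul _)) heq.symm
      measurableSet_ball
  refine (Ival_le hβ hadm).trans_eq ?_
  rw [En, setIntegral_congr_fun measurableSet_ball heq,
    integral_sub (hi.const_mul _) (hW.const_mul _), integral_const_mul, integral_const_mul, Gn,
    mul_assoc ((1 - β) / 16)]

/-- For `0 < β < 1`: if the core energies `Q_GL` and `Q_{[1,0]}(β)` exist, and for each
`ε ∈ (0,1)` there is a scalar minimizer `u_ε` with `(1/ε²)∫(1−|u_ε|²)² → 2π`, then
`2·Q_{[1,0]}(β) ≤ Q_GL − (1−β)·π/4`. -/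
theorem statement3 (β QGL Q10 : ℝ) (hβ0 : 0 < β) (hβ1 : β < 1)
    (hQGL : Tendsto (fun ε => IGL ε - Real.pi * Real.log (1 / ε))
      (nhdsWithin 0 (Ioi 0)) (nhds QGL))
    (hQ10 : Tendsto (fun ε => Ival ε β 1 0 - (Real.pi / 2) * Real.log (1 / ε))
      (nhdsWithin 0 (Ioi 0)) (nhds Q10))
    (u : ℝ → ℂ → ℂ)
    (hu : ∀ ε ∈ Ioo (0 : ℝ) 1, AdmissibleScalar ε (u ε) ∧ Gn ε (u ε) = IGL ε)
    (huconv : Tendsto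
      (fun ε => (1 / ε ^ 2) * ∫ x in ball (0 : ℂ) 1, (1 - ‖u ε x‖ ^ 2) ^ 2)
      (nhdsWithin 0 (Ioi 0)) (nhds (2 * Real.pi))) :
    2 * Q10 ≤ QGL - (1 - β) * Real.pi / 4 := by
  have hl := hQ10.const_mul 2
  have hr := hQGL.sub (huconv.const_mul ((1 - β) / 8))
  have hle := le_of_tendsto_of_tendsto hl hr ?_
  · linarith
  · filter_upwards [Ioo_mem_nhdsGT (zero_lt_one' ℝ)] with ε hε
    obtain ⟨hadm, hmin⟩ := hu ε hε
    have h := Ival_one_zero_le hβ0.le hadm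
    rw [hmin] at h
    linarith
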